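/- The coinvariant lattice of the divisor representation under ℤ₃×ℤ₃, namely L′ / span_ℤ({y − g₁·y : y ∈ L′} ∪ {y − g₂·y : y ∈ L′}), is isomorphic as an abelian group to ℤ³ ⊕ ℤ/3. (This is the computation H₀(ℤ₃×ℤ₃, R^∨) = H₄(X̃,ℤ)_G ≅ ℤ³ ⊕ ℤ₃.) -/

import Mathlib

open Matrix

/-- The generator `g₁` of the ℤ₃×ℤ₃ action on the degree-2 homology lattice of the
ℤ₃×ℤ₃-symmetric dP₉ surface, in the basis (σ, f, θ₁₁, θ₂₁, θ₃₁, θ₃₂, θ₄₁, θ₄₂, μ, ν). -/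
def g1mat : Matrix (Fin 10) (Fin 10) ℤ :=
  !![0,0,0,3,0,0,0,0,-1,-1;
     0,1,0,3,0,1,0,1,-1,-1;
     0,0,1,0,0,0,0,0,0,0;
     0,0,0,-2,0,0,0,0,1,0;
     0,0,0,-2,0,-1,0,0,1,1;
     0,0,0,-1,1,-1,0,0,0,1;
     0,0,0,-2,0,0,0,-1,1,1;
     0,0,0,-1,0,0,1,-1,0,0;
     1,0,0,-3,0,0,0,0,2,1;
     0,0,0,0,0,0,0,0,0,1]

/-- The generator `g₂` of the ℤ₃×ℤ₃ action. -/
def g2mat : Matrix (Fin 10) (Fin 10) ℤ :=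
  !![0,0,3,0,0,0,0,0,-1,-1;
     0,1,3,0,1,0,0,1,-1,-1;
     0,0,-2,0,0,0,0,0,0,1;
     0,0,0,1,0,0,0,0,0,0;
     0,0,-1,0,-1,1,0,0,1,0;
     0,0,-2,0,-1,0,0,0,1,1;
     0,0,-2,0,0,0,0,-1,1,1;
     0,0,-1,0,0,0,1,-1,0,0;
     0,0,0,0,0,0,0,0,1,0;
     1,0,-3,0,0,0,0,0,1,2]

/-- The fiber class `f`. -/
def fvec : Fin 10 → ℤ := ![0,1,0,0,0,0,0,0,0,0]

/-- The ambient rank-20 lattice ℤ¹⁰ ⊕ ℤ¹⁰. -/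
abbrev Wlat := (Fin 10 → ℤ) × (Fin 10 → ℤ)

/-- The linear form ℓ(x) = x₁ + x₉ + x₁₀. -/
def ell (x : Fin 10 → ℤ) : ℤ := x 0 + x 8 + x 9

/-- The diagonal action of a matrix `g` on ℤ¹⁰ ⊕ ℤ¹⁰. -/
def act (g : Matrix (Fin 10) (Fin 10) ℤ) (x : Wlat) : Wlat :=
  (g.mulVec x.1, g.mulVec x.2)

/-- The rank-19 lattice `L = {(a,b) : ℓ(a) = ℓ(b)}` realizing the curve
representation `R = H₂(X̃,ℤ)` of ℤ₃×ℤ₃ on the curve classes of the covering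
Calabi-Yau threefold `X̃`. -/
def Lsub : Submodule ℤ Wlat where
  carrier := {x | ell x.1 = ell x.2}
  add_mem' := by
    intro a b ha hb
    simp only [Set.mem_setOf_eq, ell, Prod.fst_add, Prod.snd_add, Pi.add_apply] at *
    omega
  zero_mem' := by simp [ell]
  smul_mem' := by
    intro c x hx
    simp only [Set.mem_setOf_eq, ell, Prod.smul_fst, Prod.smul_snd, Pi.smul_apply,
      smul_eq_mul] at *
    linear_combination c * hx

/-- The relations defining the ℤ₃×ℤ₃-coinvariants of the divisor representation
`L′ = (ℤ¹⁰ ⊕ ℤ¹⁰)/ℤ·(f,−f)`: the class `(f,−f)` together with all `x − g·x`. -/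
def Kco : Submodule ℤ Wlat :=
  Submodule.span ℤ
    ({((fvec, -fvec) : Wlat)} ∪
      {y : Wlat | ∃ x : Wlat, y = x - act g1mat x ∨ y = x - act g2mat x})

/-- The invariant form `h`, divisible by 3 on the fiber class. -/
def hform (x : Fin 10 → ℤ) : ℤ := 3 * x 1 + x 2 + x 3 + x 4 + x 5 + x 6 + x 7

lemma mulVec_g1 (x : Fin 10 → ℤ) : g1mat.mulVec x =
    ![(3) * x 3 + (-1) * x 8 + (-1) * x 9, x 1 + (3) * x 3 + x 5 + x 7 + (-1) * x 8 + (-1) * x 9, x 2, (-2) * x 3 + x 8, (-2) * x 3 + (-1) * x 5 + x 8 + x 9, (-1) * x 3 + x 4 + (-1) * x 5 + x 9, (-2) * x 3 + (-1) * x 7 + x 8 + x 9, (-1) * x 3 + x 6 + (-1) * x 7, x 0 + (-3) * x 3 + (2) * x 8 + x 9, x 9] := by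
  ext i
  fin_cases i <;> simp [g1mat, Matrix.mulVec, dotProduct, Fin.sum_univ_succ] <;> ring

lemma mulVec_g2 (x : Fin 10 → ℤ) : g2mat.mulVec x =
    ![(3) * x 2 + (-1) * x 8 + (-1) * x 9, x 1 + (3) * x 2 + x 4 + x 7 + (-1) * x 8 + (-1) * x 9, (-2) * x 2 + x 9, x 3, (-1) * x 2 + (-1) * x 4 + x 5 + x 8, (-2) * x 2 + (-1) * x 4 + x 8 + x 9, (-2) * x 2 + (-1) * x 7 + x 8 + x 9, (-1) * x 2 + x 6 + (-1) * x 7, x 8, x 0 + (-3) * x 2 + x 8 + (2) * x 9] := by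
  ext i
  fin_cases i <;> simp [g2mat, Matrix.mulVec, dotProduct, Fin.sum_univ_succ] <;> ring

lemma exists_coboundary (x : Fin 10 → ℤ) (hl : ell x = 0) (hh : hform x = 0) :
    ∃ a c : Fin 10 → ℤ, x = (a - g1mat.mulVec a) + (c - g2mat.mulVec c) := by
  refine ⟨![(-1) * x 2 + x 6 + x 7 + (-1) * x 8,
      0,
      0,
      0,
      x 1 + x 2 + x 4,
      (-1) * x 1 + (-1) * x 6 + (-1) * x 7,
      (-1) * x 7,
      0,
      (-1) * x 3,
      x 2 + x 3 + (-1) * x 6 + (-1) * x 7],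
    ![x 0 + x 2 + x 8,
      0,
      0,
      0,
      0,
      0,
      0,
      0,
      0,
      (-1) * x 2], ?_⟩
  simp only [ell, hform] at hl hh
  rw [mulVec_g1, mulVec_g2]
  ext i
  fin_cases i <;> simp <;> linarith

lemma ell_g1 (x : Fin 10 → ℤ) : ell (g1mat.mulVec x) = ell x := by
  rw [mulVec_g1]; simp [ell]; ring

lemma ell_g2 (x : Fin 10 → ℤ) : ell (g2mat.mulVec x) = ell x := by
  rw [mulVec_g2]; simp [ell]; ring

lemma hform_g1 (x : Fin 10 → ℤ) : hform (g1mat.mulVec x) = hform x := by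
  rw [mulVec_g1]; simp [hform]; ring

lemma hform_g2 (x : Fin 10 → ℤ) : hform (g2mat.mulVec x) = hform x := by
  rw [mulVec_g2]; simp [hform]; ring

lemma ell_add (x y : Fin 10 → ℤ) : ell (x + y) = ell x + ell y := by
  simp [ell]; ring

lemma hform_add (x y : Fin 10 → ℤ) : hform (x + y) = hform x + hform y := by
  simp [hform]; ring

lemma ell_sub (x y : Fin 10 → ℤ) : ell (x - y) = ell x - ell y := by
  simp [ell]; ring

lemma hform_sub (x y : Fin 10 → ℤ) : hform (x - y) = hform x - hform y := by
  simp [hform]; ring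

/-- The map `(a, b) ↦ (ℓ a, ℓ b, h a + h b, h a mod 3)`. -/
def phi : Wlat →ₗ[ℤ] ((Fin 3 → ℤ) × ZMod 3) :=
  AddMonoidHom.toIntLinearMap
    (AddMonoidHom.mk'
      (fun x => (![ell x.1, ell x.2, hform x.1 + hform x.2], ((hform x.1 : ℤ) : ZMod 3)))
      (by
        intro x y
        refine Prod.ext ?_ ?_
        · ext i
          fin_cases i <;> simp [ell_add, hform_add]
          ring
        · simp [hform_add]))

lemma phi_apply (x : Wlat) : phi x =
    (![ell x.1, ell x.2, hform x.1 + hform x.2], ((hform x.1 : ℤ) : ZMod 3)) := rfl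

lemma phi_surjective : Function.Surjective phi := by
  rintro ⟨v, t⟩
  refine ⟨(![v 0, 0, (t.val : ℤ), 0, 0, 0, 0, 0, 0, 0],
    ![v 1, 0, v 2 - (t.val : ℤ), 0, 0, 0, 0, 0, 0, 0]), ?_⟩
  rw [phi_apply]
  refine Prod.ext ?_ ?_
  · ext i
    fin_cases i <;> simp [ell, hform]
  · simp [hform]

lemma Kco_le : Kco ≤ LinearMap.ker phi := by
  refine Submodule.span_le.2 ?_
  rintro y (rfl | ⟨x, rfl | rfl⟩)
  · rw [SetLike.mem_coe, LinearMap.mem_ker, phi_apply]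
    refine Prod.ext ?_ ?_
    · ext i
      fin_cases i <;> simp [ell, hform, fvec]
    · simp [hform, fvec]
      decide
  · rw [SetLike.mem_coe, LinearMap.mem_ker, map_sub, sub_eq_zero]
    simp [phi_apply, act, ell_g1, hform_g1]
  · rw [SetLike.mem_coe, LinearMap.mem_ker, map_sub, sub_eq_zero]
    simp [phi_apply, act, ell_g2, hform_g2]

lemma ker_le : LinearMap.ker phi ≤ Kco := by
  rintro ⟨a, b⟩ hx
  rw [LinearMap.mem_ker, phi_apply] at hx
  have h1 := congrArg Prod.fst hx
  have h2 : ((hform a : ℤ) : ZMod 3) = 0 := congrArg Prod.snd hx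
  have e0 : ell a = 0 := congrFun h1 0
  have e1 : ell b = 0 := congrFun h1 1
  have e2 : hform a + hform b = 0 := congrFun h1 2
  obtain ⟨m, hm⟩ := (ZMod.intCast_zmod_eq_zero_iff_dvd (hform a) 3).1 h2
  have lf : ell (m • fvec) = 0 := by simp [ell, fvec]
  have hf : hform (m • fvec) = 3 * m := by simp [hform, fvec]
  obtain ⟨p, q, hpq⟩ := exists_coboundary (a - m • fvec) (by rw [ell_sub, e0, lf]; rfl)
    (by rw [hform_sub, hf, hm]; push_cast; ring)
  obtain ⟨r, s, hrs⟩ := exists_coboundary (b + m • fvec) (by rw [ell_add, e1, lf]; rfl)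
    (by rw [hform_add, hf]; push_cast at hm; linarith)
  have key : ((a, b) : Wlat) = m • ((fvec, -fvec) : Wlat)
      + (((p, r) : Wlat) - act g1mat (p, r)) + (((q, s) : Wlat) - act g2mat (q, s)) := by
    refine Prod.ext ?_ ?_
    · change a = m • fvec + (p - g1mat.mulVec p) + (q - g2mat.mulVec q)
      rw [add_assoc, ← hpq]; abel
    · change b = m • (-fvec) + (r - g1mat.mulVec r) + (s - g2mat.mulVec s)
      rw [add_assoc, ← hrs, smul_neg]; abel
  rw [key]
  refine add_mem (add_mem (Submodule.smul_mem _ _ ?_) ?_) ?_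
  · exact Submodule.subset_span (Or.inl rfl)
  · exact Submodule.subset_span (Or.inr ⟨_, Or.inl rfl⟩)
  · exact Submodule.subset_span (Or.inr ⟨_, Or.inr rfl⟩)

/-- The coinvariant lattice of the divisor representation under ℤ₃×ℤ₃, namely
`L′/span_ℤ({y − g₁·y} ∪ {y − g₂·y})`, is isomorphic as an abelian group to `ℤ³ ⊕ ℤ/3`.
This is the computation `H₀(ℤ₃×ℤ₃, R^∨) = H₄(X̃,ℤ)_G ≅ ℤ³ ⊕ ℤ₃`. -/
theorem coinvariant_divisor_lattice :
    Nonempty ((Wlat ⧸ Kco) ≃ₗ[ℤ] ((Fin 3 → ℤ) × ZMod 3)) := by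
  have hk : Kco = LinearMap.ker phi := le_antisymm Kco_le ker_le
  exact ⟨(Submodule.quotEquivOfEq _ _ hk).trans
    (phi.quotKerEquivOfSurjective phi_surjective)⟩
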